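/- Let q ∈ (0,1), ζ₊ > 0, ζ₋ < 0. Suppose a ∈ ζ₊^{−1}q^ℤ and b ∈ ζ₋^{−1}q^ℤ (so that b < 0 < a), and c = conj(d) ∈ ℂ∖ℝ. Then for every x ∈ Λ: W(x; q; a,b,c,d) is a strictly positive real number if b^{−1}q ≤ x ≤ a^{−1}q, and W(x; q; a,b,c,d) = 0 if x > a^{−1}q or x < b^{−1}q. Moreover the family (W(x; q; a,b,c,d))_{x∈Λ} is summable with strictly positive sum, so the normalized weights define a probability distribution on Λ supported exactly on Λ ∩ [b^{−1}q, a^{−1}q]. -/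

import Mathlib

/-- The infinite q-Pochhammer symbol `(u; q)_∞ = ∏_{n=0}^∞ (1 - u qⁿ)`. -/
noncomputable def qPochC (q : ℝ) (u : ℂ) : ℂ := ∏' n : ℕ, (1 - u * (q : ℂ) ^ n)

/-- The two-sided q-lattice `Λ = ζ₊ q^ℤ ∪ ζ₋ q^ℤ`. -/
def Lambda (q ζp ζm : ℝ) : Set ℝ := {x | ∃ n : ℤ, x = ζp * q ^ n ∨ x = ζm * q ^ n}

/-- The weight function `W(x; q; a,b,c,d) = (1-q)|x| (ax;q)_∞(bx;q)_∞ / ((cx;q)_∞(dx;q)_∞)`. -/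
noncomputable def Wc (q : ℝ) (a b c d : ℂ) (x : ℝ) : ℂ :=
  (((1 - q) * |x| : ℝ) : ℂ) * (qPochC q (a * x) * qPochC q (b * x)) /
    (qPochC q (c * x) * qPochC q (d * x))

open Filter Topology

lemma summable_norm_qPochC_factor {q : ℝ} (hq0 : 0 < q) (hq1 : q < 1) (u : ℂ) :
    Summable fun n : ℕ => ‖-(u * (q : ℂ) ^ n)‖ := by
  have h : (fun n : ℕ => ‖-(u * (q : ℂ) ^ n)‖) = fun n => ‖u‖ * q ^ n := by
    funext n
    simp [abs_of_pos hq0]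
  rw [h]
  exact (summable_geometric_of_lt_one hq0.le hq1).mul_left _

lemma multipliable_qPochC {q : ℝ} (hq0 : 0 < q) (hq1 : q < 1) (u : ℂ) :
    Multipliable fun n : ℕ => 1 - u * (q : ℂ) ^ n := by
  simpa only [sub_eq_add_neg] using
    multipliable_one_add_of_summable (summable_norm_qPochC_factor hq0 hq1 u)

lemma qPochC_eq_one_sub_mul {q : ℝ} (hq0 : 0 < q) (hq1 : q < 1) (u : ℂ) :
    qPochC q u = (1 - u) * qPochC q (u * q) := by
  have h : (fun n : ℕ => 1 - u * (q : ℂ) ^ (n + 1)) = fun n => 1 - u * q * (q : ℂ) ^ n := by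
    funext n
    ring
  unfold qPochC
  rw [tprod_eq_zero_mul' (by rw [h]; exact multipliable_qPochC hq0 hq1 (u * q)), h]
  simp

lemma qPochC_ne_zero {q : ℝ} (hq0 : 0 < q) (hq1 : q < 1) {u : ℂ}
    (hu : ∀ n : ℕ, 1 - u * (q : ℂ) ^ n ≠ 0) : qPochC q u ≠ 0 := by
  simpa only [qPochC, sub_eq_add_neg] using
    tprod_one_add_ne_zero_of_summable (f := fun n : ℕ => -(u * (q : ℂ) ^ n))
      (by simpa only [sub_eq_add_neg] using hu) (summable_norm_qPochC_factor hq0 hq1 u)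

lemma qPochC_ne_zero_of_im_ne_zero {q : ℝ} (hq0 : 0 < q) (hq1 : q < 1) {u : ℂ}
    (hu : u.im ≠ 0) : qPochC q u ≠ 0 := by
  refine qPochC_ne_zero hq0 hq1 fun n h => ?_
  have him := congrArg Complex.im h
  rw [← Complex.ofReal_pow, Complex.sub_im, Complex.im_mul_ofReal] at him
  simp [hu, hq0.ne'] at him

lemma qPochC_conj (q : ℝ) (u : ℂ) :
    qPochC q ((starRingEnd ℂ) u) = (starRingEnd ℂ) (qPochC q u) := by
  unfold qPochC
  rw [Function.LeftInverse.map_tprod (g := starRingEnd ℂ) (g' := starRingEnd ℂ) _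
    Complex.continuous_conj Complex.continuous_conj Complex.conj_conj]
  simp

lemma mul_pow_lt_one {q t : ℝ} (hq0 : 0 < q) (hq1 : q < 1) (ht : t < 1) (n : ℕ) :
    t * q ^ n < 1 := by
  have h0 : 0 < q ^ n := pow_pos hq0 n
  have h1 : q ^ n ≤ 1 := pow_le_one₀ hq0.le hq1.le
  nlinarith

lemma exists_pos_qPochC_ofReal_eq {q : ℝ} (hq0 : 0 < q) (hq1 : q < 1) {t : ℝ} (ht : t < 1) :
    ∃ r : ℝ, 0 < r ∧ qPochC q (t : ℂ) = r := by
  have hs : Summable fun n : ℕ => -(t * q ^ n) :=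
    ((summable_geometric_of_lt_one hq0.le hq1).mul_left t).neg
  have hl := Real.summable_log_one_add_of_summable hs
  have hpos : ∀ n : ℕ, 0 < 1 + -(t * q ^ n) := fun n => by
    linarith [mul_pow_lt_one hq0 hq1 ht n]
  have h := (Real.hasProd_of_hasSum_log hpos hl.hasSum).map Complex.ofRealHom
    Complex.continuous_ofReal
  refine ⟨_, Real.exp_pos _, Eq.trans ?_ h.tprod_eq⟩
  unfold qPochC
  congr 1
  funext n
  simp [sub_eq_add_neg]

lemma qPochC_eq_zero {q : ℝ} {u : ℂ} {n : ℕ} (h : u * (q : ℂ) ^ n = 1) : qPochC q u = 0 :=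
  tprod_of_exists_eq_zero ⟨n, by rw [h, sub_self]⟩

lemma Wc_pos {q : ℝ} (hq0 : 0 < q) (hq1 : q < 1) {a b x : ℝ} {c d : ℂ}
    (hcd : c = (starRingEnd ℂ) d) (hc : c.im ≠ 0) (hx : x ≠ 0) (hax : a * x < 1)
    (hbx : b * x < 1) : ∃ w : ℝ, 0 < w ∧ Wc q a b c d x = w := by
  obtain ⟨r, hr, hra⟩ := exists_pos_qPochC_ofReal_eq hq0 hq1 hax
  obtain ⟨s, hs, hsb⟩ := exists_pos_qPochC_ofReal_eq hq0 hq1 hbx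
  have hd : d.im ≠ 0 := fun h => hc (by simp [hcd, h])
  have hcx : c * x = (starRingEnd ℂ) (d * x) := by simp [hcd]
  have hD : qPochC q (d * x) ≠ 0 := qPochC_ne_zero_of_im_ne_zero hq0 hq1 (by simp [hd, hx])
  have hN : 0 < Complex.normSq (qPochC q (d * x)) := Complex.normSq_pos.2 hD
  have hq : 0 < 1 - q := sub_pos.2 hq1
  refine ⟨(1 - q) * |x| * (r * s) / Complex.normSq (qPochC q (d * x)), by positivity, ?_⟩
  rw [Complex.ofReal_mul] at hra hsb
  rw [Wc, hra, hsb, hcx, qPochC_conj, ← Complex.normSq_eq_conj_mul_self]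
  push_cast
  rfl

lemma summable_Wc_mul_pow {q : ℝ} (hq0 : 0 < q) (hq1 : q < 1) {a b s : ℝ} {c d : ℂ}
    (hcd : c = (starRingEnd ℂ) d) (hc : c.im ≠ 0) (hs : s ≠ 0) (has : a * s < 1)
    (hbs : b * s < 1) : Summable fun k : ℕ => Wc q a b c d (s * q ^ k) := by
  have ha : ∀ k : ℕ, a * (s * q ^ k) < 1 := fun k => by
    rw [← mul_assoc]; exact mul_pow_lt_one hq0 hq1 has k
  have hb : ∀ k : ℕ, b * (s * q ^ k) < 1 := fun k => by
    rw [← mul_assoc]; exact mul_pow_lt_one hq0 hq1 hbs k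
  have hne : ∀ k : ℕ, Wc q a b c d (s * q ^ k) ≠ 0 := fun k => by
    obtain ⟨w, hw, h⟩ :=
      Wc_pos hq0 hq1 hcd hc (mul_ne_zero hs (pow_ne_zero k hq0.ne')) (ha k) (hb k)
    rw [h]
    exact_mod_cast hw.ne'
  let R : ℝ → ℂ := fun x => q * ((1 - c * x) * (1 - d * x)) / ((1 - a * x) * (1 - b * x))
  have hstep : ∀ k : ℕ,
      Wc q a b c d (s * q ^ (k + 1)) = R (s * q ^ k) * Wc q a b c d (s * q ^ k) := by
    intro k
    have hx : s * q ^ k ≠ 0 := mul_ne_zero hs (pow_ne_zero k hq0.ne')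
    have hak := ha k
    have hbk := hb k
    rw [pow_succ, ← mul_assoc s]
    generalize s * q ^ k = x at hx hak hbk
    have hd : d.im ≠ 0 := fun h => hc (by simp [hcd, h])
    have hA : (1 - a * x : ℂ) ≠ 0 := by exact_mod_cast (sub_pos.2 hak).ne'
    have hB : (1 - b * x : ℂ) ≠ 0 := by exact_mod_cast (sub_pos.2 hbk).ne'
    have hC : qPochC q (c * x) ≠ 0 := qPochC_ne_zero_of_im_ne_zero hq0 hq1 (by simp [hc, hx])
    have hD : qPochC q (d * x) ≠ 0 := qPochC_ne_zero_of_im_ne_zero hq0 hq1 (by simp [hd, hx])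
    have e : ∀ u : ℂ, qPochC q (u * x) = (1 - u * x) * qPochC q (u * (x * q : ℝ)) := fun u => by
      rw [qPochC_eq_one_sub_mul hq0 hq1, Complex.ofReal_mul, mul_assoc u]
    rw [e] at hC hD
    obtain ⟨hC1, hC2⟩ := mul_ne_zero_iff.1 hC
    obtain ⟨hD1, hD2⟩ := mul_ne_zero_iff.1 hD
    simp only [R, Wc, e a, e b, e c, e d, abs_mul, abs_of_pos hq0]
    generalize (1 - a * x : ℂ) = A at hA ⊢
    generalize (1 - b * x : ℂ) = B at hB ⊢
    generalize 1 - c * (x : ℂ) = C at hC1 ⊢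
    generalize 1 - d * (x : ℂ) = D at hD1 ⊢
    generalize qPochC q (c * (x * q : ℝ)) = C' at hC2 ⊢
    generalize qPochC q (d * (x * q : ℝ)) = D' at hD2 ⊢
    push_cast
    field_simp
  have hlim : Tendsto (fun k : ℕ => ‖R (s * q ^ k)‖) atTop (𝓝 ‖R 0‖) := by
    have hcont : ContinuousAt R 0 := by
      refine ContinuousAt.div (by fun_prop) (by fun_prop) (by simp)
    have h0 : Tendsto (fun k : ℕ => s * q ^ k) atTop (𝓝 0) := by
      simpa using (tendsto_pow_atTop_nhds_zero_of_lt_one hq0.le hq1).const_mul s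
    exact (hcont.tendsto.comp h0).norm
  refine summable_of_ratio_test_tendsto_lt_one (l := ‖R 0‖) (by simpa [R, abs_of_pos hq0] using hq1)
    (Eventually.of_forall hne) (hlim.congr fun k => ?_)
  rw [hstep, norm_mul, mul_div_cancel_right₀ _ (norm_ne_zero_iff.2 (hne k))]

lemma mem_Lambda_iff_of_eq {q ζp ζm a b : ℝ} (hq0 : 0 < q)
    (ha : ∃ n : ℤ, a = ζp⁻¹ * q ^ n) (hb : ∃ n : ℤ, b = ζm⁻¹ * q ^ n) {x : ℝ} :
    x ∈ Lambda q ζp ζm ↔ ∃ n : ℤ, x = a⁻¹ * q ^ n ∨ x = b⁻¹ * q ^ n := by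
  obtain ⟨i, rfl⟩ := ha
  obtain ⟨j, rfl⟩ := hb
  have key : ∀ (z : ℝ) (i n : ℤ), (z⁻¹ * q ^ i)⁻¹ * q ^ n = z * q ^ (n - i) := fun z i n => by
    rw [mul_inv, inv_inv, zpow_sub₀ hq0.ne']
    field_simp
  simp only [key]
  constructor
  · rintro ⟨n, h | h⟩
    · exact ⟨n + i, Or.inl (by simpa using h)⟩
    · exact ⟨n + j, Or.inr (by simpa using h)⟩
  · rintro ⟨n, h | h⟩
    · exact ⟨n - i, Or.inl h⟩
    · exact ⟨n - j, Or.inr h⟩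

lemma qPochC_mul_inv_mul_zpow_eq_zero {q a : ℝ} (hq0 : 0 < q) (ha : a ≠ 0) {n : ℤ} (hn : n ≤ 0) :
    qPochC q (a * (a⁻¹ * q ^ n : ℝ)) = 0 := by
  obtain ⟨k, rfl⟩ : ∃ k : ℕ, n = -k := ⟨n.natAbs, by omega⟩
  refine qPochC_eq_zero (n := k) ?_
  have h : a * (a⁻¹ * q ^ (-(k : ℤ))) * q ^ k = 1 := by
    rw [zpow_neg, zpow_natCast]
    field_simp
  exact_mod_cast h

/-- A summable function on the nonnegative parts of two geometric progressions, extended by zero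
to the rest of a set containing both, is summable on that set. -/
lemma summable_subtype_of_summable_progressions {q s t : ℝ} (hq0 : 0 < q) (hq1 : q < 1)
    (hs : 0 < s) (ht : t < 0) {S : Set ℝ} {f : ℝ → ℝ}
    (hsS : ∀ k : ℕ, s * q ^ k ∈ S) (htS : ∀ k : ℕ, t * q ^ k ∈ S)
    (hf : ∀ x ∈ S, (∀ k : ℕ, x ≠ s * q ^ k) → (∀ k : ℕ, x ≠ t * q ^ k) → f x = 0)
    (hfs : Summable fun k : ℕ => f (s * q ^ k)) (hft : Summable fun k : ℕ => f (t * q ^ k)) :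
    Summable fun x : S => f x := by
  let g : ℕ ⊕ ℕ → S := Sum.elim (fun k => ⟨_, hsS k⟩) fun k => ⟨_, htS k⟩
  have hinj : ∀ r : ℝ, r ≠ 0 → Function.Injective fun k : ℕ => r * q ^ k := fun r hr =>
    (mul_right_injective₀ hr).comp (pow_right_injective₀ hq0 hq1.ne)
  have hg : Function.Injective g := by
    refine Function.Injective.sumElim ?_ ?_ ?_
    · exact fun i j h => hinj s hs.ne' (congrArg Subtype.val h)
    · exact fun i j h => hinj t ht.ne (congrArg Subtype.val h)
    · intro i j h
      have h' : s * q ^ i = t * q ^ j := congrArg Subtype.val h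
      have h1 : 0 < s * q ^ i := by positivity
      have h2 : t * q ^ j < 0 := mul_neg_of_neg_of_pos ht (by positivity)
      linarith
  refine (hg.summable_iff fun x hx => hf x x.2 (fun k h => hx ⟨Sum.inl k, Subtype.ext h.symm⟩)
    fun k h => hx ⟨Sum.inr k, Subtype.ext h.symm⟩).1 ?_
  exact Summable.sum _ hfs hft

lemma Wc_pos_of_mem_Icc {q : ℝ} (hq0 : 0 < q) (hq1 : q < 1) {a b x : ℝ} {c d : ℂ}
    (ha0 : 0 < a) (hb0 : b < 0) (hcd : c = (starRingEnd ℂ) d) (hc : c.im ≠ 0) (hx : x ≠ 0)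
    (h1 : b⁻¹ * q ≤ x) (h2 : x ≤ a⁻¹ * q) : ∃ w : ℝ, 0 < w ∧ Wc q a b c d x = w := by
  refine Wc_pos hq0 hq1 hcd hc hx ?_ ?_
  · have := mul_le_mul_of_nonneg_left h2 ha0.le
    rw [mul_inv_cancel_left₀ ha0.ne'] at this
    linarith
  · have := mul_le_mul_of_nonpos_left h1 hb0.le
    rw [mul_inv_cancel_left₀ hb0.ne] at this
    linarith

lemma mem_Icc_of_eq_inv_mul_zpow {q a b x : ℝ} (hq0 : 0 < q) (hq1 : q < 1) (ha0 : 0 < a)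
    (hb0 : b < 0) {n : ℤ} (hn : 1 ≤ n) (hx : x = a⁻¹ * q ^ n ∨ x = b⁻¹ * q ^ n) :
    b⁻¹ * q ≤ x ∧ x ≤ a⁻¹ * q := by
  have ha' : 0 < a⁻¹ := inv_pos.2 ha0
  have hb' : b⁻¹ < 0 := inv_lt_zero.2 hb0
  have h1 : q ^ n ≤ q := by simpa using zpow_le_zpow_right_of_le_one₀ hq0 hq1.le hn
  have h2 : 0 < q ^ n := zpow_pos hq0 n
  rcases hx with rfl | rfl
  · exact ⟨(mul_neg_of_neg_of_pos hb' hq0).le.trans (mul_pos ha' h2).le,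
      mul_le_mul_of_nonneg_left h1 ha'.le⟩
  · exact ⟨mul_le_mul_of_nonpos_left h1 hb'.le,
      (mul_neg_of_neg_of_pos hb' h2).le.trans (mul_pos ha' hq0).le⟩

lemma Wc_eq_zero_of_eq_inv_mul_zpow {q a b x : ℝ} (c d : ℂ) (hq0 : 0 < q) (ha0 : a ≠ 0)
    (hb0 : b ≠ 0) {n : ℤ} (hn : n ≤ 0) (hx : x = a⁻¹ * q ^ n ∨ x = b⁻¹ * q ^ n) :
    Wc q a b c d x = 0 := by
  rcases hx with rfl | rfl
  · rw [Wc, qPochC_mul_inv_mul_zpow_eq_zero hq0 ha0 hn]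
    simp
  · rw [Wc, qPochC_mul_inv_mul_zpow_eq_zero hq0 hb0 hn]
    simp

lemma summable_Wc_re {q ζp ζm a b : ℝ} {c d : ℂ} (hq0 : 0 < q) (hq1 : q < 1)
    (ha0 : 0 < a) (hb0 : b < 0) (hcd : c = (starRingEnd ℂ) d) (hc : c.im ≠ 0)
    (hmem : ∀ x, x ∈ Lambda q ζp ζm ↔ ∃ n : ℤ, x = a⁻¹ * q ^ n ∨ x = b⁻¹ * q ^ n) :
    Summable fun x : Lambda q ζp ζm => (Wc q a b c d x).re := by
  have ha' : 0 < a⁻¹ := inv_pos.2 ha0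
  have hb' : b⁻¹ < 0 := inv_lt_zero.2 hb0
  have hpow : ∀ k : ℕ, q * q ^ k = q ^ ((k : ℤ) + 1) := fun k => by
    rw [zpow_add₀ hq0.ne', zpow_natCast, zpow_one, mul_comm]
  have hsumA : Summable fun k : ℕ => Wc q a b c d (a⁻¹ * q * q ^ k) := by
    refine summable_Wc_mul_pow hq0 hq1 hcd hc (by positivity) ?_ ?_
    · rwa [mul_inv_cancel_left₀ ha0.ne']
    · exact (mul_neg_of_neg_of_pos hb0 (mul_pos ha' hq0)).trans one_pos
  have hsumB : Summable fun k : ℕ => Wc q a b c d (b⁻¹ * q * q ^ k) := by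
    refine summable_Wc_mul_pow hq0 hq1 hcd hc (mul_ne_zero hb'.ne hq0.ne') ?_ ?_
    · exact (mul_neg_of_pos_of_neg ha0 (mul_neg_of_neg_of_pos hb' hq0)).trans one_pos
    · rwa [mul_inv_cancel_left₀ hb0.ne]
  refine summable_subtype_of_summable_progressions (f := fun x => (Wc q a b c d x).re)
    hq0 hq1 (mul_pos ha' hq0) (mul_neg_of_neg_of_pos hb' hq0)
    (fun k => (hmem _).2 ⟨k + 1, Or.inl (by rw [mul_assoc, hpow])⟩)
    (fun k => (hmem _).2 ⟨k + 1, Or.inr (by rw [mul_assoc, hpow])⟩) ?_ ?_ ?_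
  · intro x hx h1 h2
    obtain ⟨n, hn⟩ := (hmem x).1 hx
    rw [Wc_eq_zero_of_eq_inv_mul_zpow c d hq0 ha0.ne' hb0.ne ?_ hn, Complex.zero_re]
    by_contra! h'
    obtain ⟨k, rfl⟩ : ∃ k : ℕ, n = k + 1 := ⟨(n - 1).toNat, by omega⟩
    rw [← hpow, ← mul_assoc, ← mul_assoc] at hn
    exact hn.elim (h1 k) (h2 k)
  · exact (Complex.hasSum_re hsumA.hasSum).summable
  · exact (Complex.hasSum_re hsumB.hasSum).summable

/-- Degenerate series (N = 1): for `a ∈ ζ₊⁻¹ q^ℤ`, `b ∈ ζ₋⁻¹ q^ℤ` (so `b < 0 < a`) and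
`c = conj d ∈ ℂ∖ℝ`: the weight `W(x)` is a strictly positive real for `x ∈ Λ` with
`b⁻¹q ≤ x ≤ a⁻¹q`, vanishes for `x ∈ Λ` outside `[b⁻¹q, a⁻¹q]`, the weights are summable
with strictly positive sum, and the normalized weights form a probability distribution
on `Λ` supported exactly on `Λ ∩ [b⁻¹q, a⁻¹q]`. -/
theorem stmt4 (q ζp ζm : ℝ) (hq0 : 0 < q) (hq1 : q < 1) (hζp : 0 < ζp) (hζm : ζm < 0)
    (a b : ℝ) (ha : ∃ n : ℤ, a = ζp⁻¹ * q ^ n) (hb : ∃ n : ℤ, b = ζm⁻¹ * q ^ n)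
    (c d : ℂ) (hcd : c = (starRingEnd ℂ) d) (hc : c.im ≠ 0) :
    (∀ x ∈ Lambda q ζp ζm,
      (b⁻¹ * q ≤ x ∧ x ≤ a⁻¹ * q →
        0 < (Wc q (a : ℂ) (b : ℂ) c d x).re ∧ (Wc q (a : ℂ) (b : ℂ) c d x).im = 0) ∧
      (a⁻¹ * q < x ∨ x < b⁻¹ * q → Wc q (a : ℂ) (b : ℂ) c d x = 0)) ∧
    Summable (fun x : Lambda q ζp ζm => (Wc q (a : ℂ) (b : ℂ) c d (x : ℝ)).re) ∧
    0 < (∑' y : Lambda q ζp ζm, (Wc q (a : ℂ) (b : ℂ) c d (y : ℝ)).re) ∧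
    (∀ x : Lambda q ζp ζm,
      (0 < (Wc q (a : ℂ) (b : ℂ) c d (x : ℝ)).re /
          (∑' y : Lambda q ζp ζm, (Wc q (a : ℂ) (b : ℂ) c d (y : ℝ)).re)) ↔
        (x : ℝ) ∈ Set.Icc (b⁻¹ * q) (a⁻¹ * q)) ∧
    ∑' x : Lambda q ζp ζm,
      (Wc q (a : ℂ) (b : ℂ) c d (x : ℝ)).re /
        (∑' y : Lambda q ζp ζm, (Wc q (a : ℂ) (b : ℂ) c d (y : ℝ)).re) = 1 := by
  have ha0 : 0 < a := by
    obtain ⟨n, rfl⟩ := ha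
    positivity
  have hb0 : b < 0 := by
    obtain ⟨n, rfl⟩ := hb
    exact mul_neg_of_neg_of_pos (inv_lt_zero.2 hζm) (by positivity)
  have hmem {x : ℝ} := mem_Lambda_iff_of_eq (x := x) hq0 ha hb
  have ha' : 0 < a⁻¹ := inv_pos.2 ha0
  have hb' : b⁻¹ < 0 := inv_lt_zero.2 hb0
  have hΛ0 : ∀ x ∈ Lambda q ζp ζm, x ≠ 0 := by
    intro x hx
    obtain ⟨n, rfl | rfl⟩ := hmem.1 hx
    · positivity
    · exact mul_ne_zero hb'.ne (by positivity)
  have hzero : ∀ x ∈ Lambda q ζp ζm, ¬(b⁻¹ * q ≤ x ∧ x ≤ a⁻¹ * q) → Wc q a b c d x = 0 := by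
    intro x hx h
    obtain ⟨n, hn⟩ := hmem.1 hx
    refine Wc_eq_zero_of_eq_inv_mul_zpow c d hq0 ha0.ne' hb0.ne ?_ hn
    by_contra! h'
    exact h (mem_Icc_of_eq_inv_mul_zpow hq0 hq1 ha0 hb0 (by omega) hn)
  have hsum := summable_Wc_re hq0 hq1 ha0 hb0 hcd hc fun x => hmem (x := x)
  have hre_pos : ∀ x : Lambda q ζp ζm, b⁻¹ * q ≤ (x : ℝ) → (x : ℝ) ≤ a⁻¹ * q →
      0 < (Wc q (a : ℂ) (b : ℂ) c d (x : ℝ)).re := by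
    intro x h1 h2
    obtain ⟨w, hw, h⟩ := Wc_pos_of_mem_Icc hq0 hq1 ha0 hb0 hcd hc (hΛ0 x x.2) h1 h2
    rwa [h, Complex.ofReal_re]
  have hre_nonneg : ∀ x : Lambda q ζp ζm, 0 ≤ (Wc q (a : ℂ) (b : ℂ) c d (x : ℝ)).re := by
    intro x
    by_cases h : b⁻¹ * q ≤ (x : ℝ) ∧ (x : ℝ) ≤ a⁻¹ * q
    · exact (hre_pos x h.1 h.2).le
    · rw [hzero x x.2 h, Complex.zero_re]
  have hone : a⁻¹ * q = a⁻¹ * q ^ (1 : ℤ) ∨ a⁻¹ * q = b⁻¹ * q ^ (1 : ℤ) :=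
    Or.inl (by rw [zpow_one])
  have hIcc := mem_Icc_of_eq_inv_mul_zpow hq0 hq1 ha0 hb0 le_rfl hone
  have htot : 0 < ∑' y : Lambda q ζp ζm, (Wc q (a : ℂ) (b : ℂ) c d (y : ℝ)).re :=
    hsum.tsum_pos hre_nonneg ⟨a⁻¹ * q, hmem.2 ⟨1, hone⟩⟩
      (hre_pos _ hIcc.1 hIcc.2)
  refine ⟨fun x hx => ⟨fun h => ?_, fun h => hzero x hx fun h' => ?_⟩, hsum, htot, fun x => ?_, ?_⟩
  · obtain ⟨w, hw, e⟩ := Wc_pos_of_mem_Icc hq0 hq1 ha0 hb0 hcd hc (hΛ0 x hx) h.1 h.2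
    simpa [e] using hw
  · exact h.elim h'.2.not_gt h'.1.not_gt
  · rw [div_pos_iff_of_pos_right htot]
    refine ⟨fun h => ?_, fun h => hre_pos x h.1 h.2⟩
    by_contra h'
    rw [hzero x x.2 h', Complex.zero_re] at h
    exact h.false
  · rw [tsum_div_const, div_self htot.ne']
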